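/- Assume in addition that ε > 0 and that n₀ is such that for all i ∈ {1, …, r}, j ∈ {1, …, t} and k ∈ B^i_{m_j}, E^k_{σ^{m_j}}[(1/n₀) Σ_{m=1}^{n₀} g_m] ≥ γ^i_∞ − ε, and that γ^{p*}_∞(σ) = v_∞(p₁) for an initial belief p₁. Then for every S ≥ 1, E^{p*}_{σ'}[(1/(Sn₀)) Σ_{m=1}^{Sn₀} g_m] ≥ v_∞(p₁) − ε. -/

import Mathlib

open MeasureTheory Filter

namespace PomdpPaper

/-- A belief (probability vector) on `Fin n`. -/
def IsBelief {n : ℕ} (p : Fin n → ℝ) : Prop :=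
  (∀ k, 0 ≤ p k) ∧ ∑ k, p k = 1

/-- The measure on a finite type associated with a probability vector. -/
noncomputable def vecMeasure {α : Type*} [Fintype α] [MeasurableSpace α] (p : α → ℝ) :
    Measure α :=
  ∑ x : α, ENNReal.ofReal (p x) • Measure.dirac x

/-- The Dirac belief at a point. -/
def diracBelief {n : ℕ} (k : Fin n) : Fin n → ℝ := fun k' => if k' = k then 1 else 0

/-- The `i`-th binary digit of a real number `x ∈ [0,1)` (as a real number `0` or `1`). -/
noncomputable def digitR (x : ℝ) (i : ℕ) : ℝ :=
  if ⌊x * 2 ^ (i + 1)⌋ % 2 = 1 then 1 else 0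

/-- From one uniform seed `x ∈ [0,1)`, a sequence `unif x 0, unif x 1, …` of
(independent, uniformly distributed on `[0,1]`) real numbers, obtained by splitting the
binary digits of `x` along the pairing function. -/
noncomputable def unif (x : ℝ) (m : ℕ) : ℝ :=
  ∑' j : ℕ, digitR x (Nat.pair m j) / 2 ^ (j + 1)

open Classical in
/-- Inverse-transform sampling from a probability vector on `Fin n` using a seed `u ∈ [0,1]`. -/
noncomputable def sampleFin {n : ℕ} (hn : 0 < n) (p : Fin n → ℝ) (u : ℝ) : Fin n :=
  let s : Finset (Fin n) :=
    Finset.univ.filter fun y : Fin n => u < ∑ z ∈ Finset.univ.filter fun z : Fin n => z ≤ y, p z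
  if hs : s.Nonempty then s.min' hs else ⟨0, hn⟩

/-- Inverse-transform sampling from a probability vector on a finite nonempty type. -/
noncomputable def sampleOn {β : Type*} [Fintype β] [Nonempty β] (p : β → ℝ) (u : ℝ) : β :=
  (Fintype.equivFin β).symm
    (sampleFin Fintype.card_pos (fun i => p ((Fintype.equivFin β).symm i)) u)

/-- A POMDP with states `Fin nK`, actions `Fin nA`, signals `Fin nS`, transition function `q`
and reward function `g` with values in `[0,1]`. -/
structure POMDP where
  nK : ℕ
  nA : ℕ
  nS : ℕ
  hK : 0 < nK
  hA : 0 < nA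
  hS : 0 < nS
  q : Fin nK → Fin nA → Fin nK × Fin nS → ℝ
  q_nonneg : ∀ k a y, 0 ≤ q k a y
  q_sum : ∀ k a, ∑ y, q k a y = 1
  g : Fin nK → Fin nA → ℝ
  g_nonneg : ∀ k a, 0 ≤ g k a
  g_le_one : ∀ k a, g k a ≤ 1

namespace POMDP

variable (Γ : POMDP)

/-- The state space. -/
abbrev K := Fin Γ.nK
/-- The action space. -/
abbrev A := Fin Γ.nA
/-- The signal space. -/
abbrev S := Fin Γ.nS

instance : Nonempty Γ.K := ⟨⟨0, Γ.hK⟩⟩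
instance : Nonempty Γ.A := ⟨⟨0, Γ.hA⟩⟩
instance : Nonempty Γ.S := ⟨⟨0, Γ.hS⟩⟩

/-- A history: the finite sequence of past actions and signals. -/
abbrev Hist := List (Γ.A × Γ.S)

/-- A (pure) strategy: a map from histories to actions. -/
abbrev Strategy := Γ.Hist → Γ.A

/-- The sample space carrying all the randomness: an initial state together with a
uniform seed in `[0,1)` used to draw all the transitions. -/
abbrev Env := Γ.K × ℝ

/-- The probability measure on the sample space induced by the initial belief `p1`:
the initial state is drawn according to `p1`, the seed uniformly on `[0,1)`. -/
noncomputable def envMeasure (p1 : Γ.K → ℝ) : Measure Γ.Env :=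
  (vecMeasure p1).prod (volume.restrict (Set.Ico (0 : ℝ) 1))

/-- The trajectory: `(Γ.traj σ ω m).1` is the state `k_{m+1}` at stage `m+1` and
`(Γ.traj σ ω m).2` is the history before stage `m+1` (of length `m`), when the
decision-maker uses strategy `σ` and the randomness is `ω`.  At each stage, the pair
(new state, signal) is drawn from `q` via inverse-transform sampling from a fresh
uniform variable. -/
noncomputable def traj (σ : Γ.Strategy) (ω : Γ.Env) : ℕ → Γ.K × Γ.Hist
  | 0 => (ω.1, [])
  | m + 1 =>
    let p := traj σ ω m
    let a := σ p.2
    let y := sampleOn (Γ.q p.1 a) (unif ω.2 m)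
    (y.1, p.2 ++ [(a, y.2)])

/-- The state `k_{m+1}` at stage `m+1` (`m` is 0-indexed). -/
noncomputable def state (σ : Γ.Strategy) (ω : Γ.Env) (m : ℕ) : Γ.K := (Γ.traj σ ω m).1

/-- The history before stage `m+1` (a list of length `m`). -/
noncomputable def hist (σ : Γ.Strategy) (ω : Γ.Env) (m : ℕ) : Γ.Hist := (Γ.traj σ ω m).2

/-- The action `a_{m+1}` played at stage `m+1`. -/
noncomputable def act (σ : Γ.Strategy) (ω : Γ.Env) (m : ℕ) : Γ.A := σ (Γ.hist σ ω m)

/-- The reward `g_{m+1}` obtained at stage `m+1`. -/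
noncomputable def rew (σ : Γ.Strategy) (ω : Γ.Env) (m : ℕ) : ℝ :=
  Γ.g (Γ.state σ ω m) (Γ.act σ ω m)

/-- The average reward over the first `n` stages. -/
noncomputable def avg (σ : Γ.Strategy) (ω : Γ.Env) (n : ℕ) : ℝ :=
  (1 / n : ℝ) * ∑ m ∈ Finset.range n, Γ.rew σ ω m

/-- The probability of an event under initial belief `p1` (the strategy `σ` is recorded for
readability; the underlying measure does not depend on it). -/
noncomputable def prob (p1 : Γ.K → ℝ) (_σ : Γ.Strategy) (E : Set Γ.Env) : ℝ :=
  (Γ.envMeasure p1 E).toReal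

/-- The long-run average payoff `γ^{p1}_∞(σ) = E[liminf (1/n) ∑ g_m]`. -/
noncomputable def pay (p1 : Γ.K → ℝ) (σ : Γ.Strategy) : ℝ :=
  ∫ ω, atTop.liminf (Γ.avg σ ω) ∂(Γ.envMeasure p1)

/-- The payoff starting from a deterministic state `k`, i.e. `γ^k_∞(σ)`. -/
noncomputable def payK (k : Γ.K) (σ : Γ.Strategy) : ℝ := Γ.pay (diracBelief k) σ

/-- The value `v_∞(p1)`. -/
noncomputable def val (p1 : Γ.K → ℝ) : ℝ := ⨆ σ : Γ.Strategy, Γ.pay p1 σ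

/-- A strategy has finite memory if it is implemented by a finite-state transducer. -/
def FiniteMemory (σ : Γ.Strategy) : Prop :=
  ∃ (n : ℕ) (m0 : Fin n) (σa : Fin n → Γ.A) (σu : Fin n → Γ.A × Γ.S → Fin n),
    ∀ h : Γ.Hist, σ h = σa (h.foldl σu m0)

/-- A blind MDP: the signal set is a singleton. -/
def Blind : Prop := Γ.nS = 1

/-- The strategy induced by a sequence of actions `a_1, a_2, …` (`as m` is the action played
at stage `m+1`, regardless of the observed history). -/
def blindStrat (as : ℕ → Γ.A) : Γ.Strategy := fun h => as h.length

end POMDP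

/-- A sequence is eventually periodic if it is periodic with some period `T ≥ 1` from
some stage `N` on. -/
def EventuallyPeriodic {α : Type*} (as : ℕ → α) : Prop :=
  ∃ T ≥ 1, ∃ N ≥ 1, ∀ m ≥ N, as (m + T) = as m


namespace POMDP

variable (Γ : POMDP)

/-- `Γ.stateProb k σ m k'` is the probability that the state at stage `m + 1` is `k'`,
starting from state `k` and playing `σ`. -/
noncomputable def stateProb (k : Γ.K) (σ : Γ.Strategy) (m : ℕ) (k' : Γ.K) : ℝ :=
  Γ.prob (diracBelief k) σ {ω | Γ.state σ ω m = k'}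

/-- The super-support at stage `m + 1` associated with the classes `Kc`:
`Γ.superSupp as Kc m i` is the set of states reached with positive probability at stage
`m + 1` under the blind strategy `as`, starting from a state in `Kc i`. -/
noncomputable def superSupp (as : ℕ → Γ.A) {r : ℕ} (Kc : Fin r → Finset Γ.K)
    (m : ℕ) (i : Fin r) : Set Γ.K :=
  {k' | ∃ k ∈ Kc i, 0 < Γ.stateProb k (Γ.blindStrat as) m k'}

end POMDP

/-- The `m`-shift of a sequence of actions. -/
def shiftSeq {α : Type*} (as : ℕ → α) (m : ℕ) : ℕ → α := fun t => as (m + t)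

open Classical in
/-- The representative stages used to define the eventually periodic strategy `σ'`:
`repStage Γ as Kc n0 0 = 0`, and `repStage Γ as Kc n0 (s+1)` is the least stage whose
super-support coincides with the super-support at stage `repStage Γ as Kc n0 s + n0`. -/
noncomputable def repStage (Γ : POMDP) (as : ℕ → Γ.A) {r : ℕ}
    (Kc : Fin r → Finset Γ.K) (n0 : ℕ) : ℕ → ℕ
  | 0 => 0
  | s + 1 =>
    have hex : ∃ m, Γ.superSupp as Kc m
        = Γ.superSupp as Kc (repStage Γ as Kc n0 s + n0) :=
      ⟨repStage Γ as Kc n0 s + n0, rfl⟩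
    Nat.find hex

/-- The strategy `σ'`: during the block of stages `s·n0 + 1, …, (s+1)·n0`, play the actions
that `σ` plays from stage `repStage … s` on. -/
noncomputable def blindSigma' (Γ : POMDP) (as : ℕ → Γ.A) {r : ℕ}
    (Kc : Fin r → Finset Γ.K) (n0 : ℕ) : ℕ → Γ.A :=
  fun m => as (repStage Γ as Kc n0 (m / n0) + m % n0)

section Digits
open ProbabilityTheory

noncomputable abbrev lam : Measure ℝ := volume.restrict (Set.Ico (0 : ℝ) 1)

instance lam_prob : IsProbabilityMeasure lam := ⟨by simp [lam]⟩

def dset (i : ℕ) : Set ℝ := {x | ⌊x * 2 ^ (i + 1)⌋ % 2 = 1}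

lemma measurableSet_dset (i : ℕ) : MeasurableSet (dset i) := by
  have h : Measurable (fun x : ℝ => ⌊x * 2 ^ (i + 1)⌋ % 2) :=
    (measurable_of_countable (fun z : ℤ => z % 2)).comp
      (Int.measurable_floor.comp (measurable_id.mul_const _))
  exact h (measurableSet_singleton 1)

lemma digitR_eq (i : ℕ) : (fun x => digitR x i) = (dset i).indicator (fun _ => (1 : ℝ)) := by
  funext x
  simp only [digitR, Set.indicator, dset, Set.mem_ofPred_eq]
  congr

lemma measurable_digitR (i : ℕ) : Measurable (fun x => digitR x i) := by
  rw [digitR_eq]; exact measurable_const.indicator (measurableSet_dset i)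

lemma dset_succ (i : ℕ) (x : ℝ) : x ∈ dset (i + 1) ↔ 2 * x ∈ dset i := by
  simp only [dset, Set.mem_ofPred_eq]
  have : x * 2 ^ (i + 1 + 1) = 2 * x * 2 ^ (i + 1) := by ring
  rw [this]

lemma dset_periodic (i : ℕ) (x : ℝ) : x + 1 ∈ dset i ↔ x ∈ dset i := by
  simp only [dset, Set.mem_ofPred_eq]
  have : (x + 1) * 2 ^ (i + 1) = x * 2 ^ (i + 1) + ((2 * 2 ^ i : ℤ) : ℝ) := by
    push_cast; ring
  rw [this, Int.floor_add_intCast]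
  omega

lemma dset_zero (x : ℝ) (hx : x ∈ Set.Ico (0 : ℝ) 1) : x ∈ dset 0 ↔ 1 / 2 ≤ x := by
  simp only [dset, Set.mem_ofPred_eq]
  obtain ⟨h0, h1⟩ := hx
  constructor
  · intro h
    by_contra hlt
    have : ⌊x * 2 ^ (0 + 1)⌋ = 0 := by
      rw [Int.floor_eq_iff]; push_cast; constructor <;> norm_num <;> linarith
    omega
  · intro h
    have : ⌊x * 2 ^ (0 + 1)⌋ = 1 := by
      rw [Int.floor_eq_iff]; push_cast; constructor <;> norm_num <;> linarith
    omega

lemma vol_half (B : Set ℝ) : volume ((fun x : ℝ => 2 * x) ⁻¹' B) = 2⁻¹ * volume B := by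
  have := Real.volume_preimage_mul_left (a := 2) (by norm_num) B
  rw [this]
  congr 1
  rw [abs_of_pos (by norm_num), ENNReal.ofReal_inv_of_pos (by norm_num)]
  simp

lemma lam_half_top (A : Set ℝ) (hA : MeasurableSet A) (hp : ∀ x, x + 1 ∈ A ↔ x ∈ A) :
    lam (dset 0 ∩ (fun x : ℝ => 2 * x) ⁻¹' A) = 2⁻¹ * lam A := by
  have hm : Measurable (fun x : ℝ => 2 * x) := measurable_const_mul 2
  rw [Measure.restrict_apply ((measurableSet_dset 0).inter (hm hA)), Measure.restrict_apply hA]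
  have e1 : dset 0 ∩ (fun x : ℝ => 2 * x) ⁻¹' A ∩ Set.Ico 0 1
      = (fun x : ℝ => 2 * x) ⁻¹' (A ∩ Set.Ico 1 2) := by
    ext x
    simp only [Set.mem_inter_iff, Set.mem_preimage, Set.mem_Ico]
    constructor
    · rintro ⟨⟨h1, h2⟩, h3⟩
      rw [dset_zero x h3] at h1
      exact ⟨h2, by linarith, by linarith [h3.2]⟩
    · rintro ⟨h1, h2, h3⟩
      have h4 : x ∈ Set.Ico (0 : ℝ) 1 := ⟨by linarith, by linarith⟩
      exact ⟨⟨(dset_zero x h4).2 (by linarith), h1⟩, h4⟩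
  have e2 : A ∩ Set.Ico 0 1 = (fun x : ℝ => x + 1) ⁻¹' (A ∩ Set.Ico 1 2) := by
    ext x
    simp only [Set.mem_inter_iff, Set.mem_preimage, Set.mem_Ico, hp]
    constructor <;> rintro ⟨h1, h2, h3⟩ <;> exact ⟨h1, by linarith, by linarith⟩
  rw [e1, vol_half, e2, measure_preimage_add_right]

lemma lam_half_all (A : Set ℝ) (hA : MeasurableSet A) (hp : ∀ x, x + 1 ∈ A ↔ x ∈ A) :
    lam ((fun x : ℝ => 2 * x) ⁻¹' A) = lam A := by
  have hm : Measurable (fun x : ℝ => 2 * x) := measurable_const_mul 2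
  rw [← measure_inter_add_sdiff _ (measurableSet_dset 0), Set.inter_comm, lam_half_top A hA hp]
  rw [Measure.restrict_apply ((hm hA).diff (measurableSet_dset 0)), Measure.restrict_apply hA]
  have e1 : ((fun x : ℝ => 2 * x) ⁻¹' A \ dset 0) ∩ Set.Ico 0 1
      = (fun x : ℝ => 2 * x) ⁻¹' (A ∩ Set.Ico 0 1) := by
    ext x
    simp only [Set.mem_inter_iff, Set.mem_preimage, Set.mem_Ico, Set.mem_sdiff]
    constructor
    · rintro ⟨⟨h1, h2⟩, h3⟩
      rw [dset_zero x h3] at h2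
      exact ⟨h1, by linarith [h3.1], by linarith⟩
    · rintro ⟨h1, h2, h3⟩
      have h4 : x ∈ Set.Ico (0 : ℝ) 1 := ⟨by linarith, by linarith⟩
      exact ⟨⟨h1, fun h => by have := (dset_zero x h4).1 h; linarith⟩, h4⟩
  rw [e1, vol_half, ← add_mul, ENNReal.inv_two_add_inv_two, one_mul]

lemma lam_inter (n : ℕ) : ∀ s : Finset ℕ, (∀ i ∈ s, i < n) →
    lam (⋂ i ∈ s, dset i) = 2⁻¹ ^ s.card := by
  induction n with
  | zero =>
    intro s hs
    have : s = ∅ := Finset.eq_empty_of_forall_notMem fun i hi => by simpa using hs i hi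
    subst this; simp
  | succ n ih =>
    intro s hs
    set s' := (Finset.range n).filter (fun i => i + 1 ∈ s) with hs'
    have hmem : ∀ i, i ∈ s' ↔ i + 1 ∈ s := by
      intro i
      simp only [hs', Finset.mem_filter, Finset.mem_range]
      exact ⟨fun h => h.2, fun h => ⟨by have := hs _ h; omega, h⟩⟩
    have ih' := ih s' (fun i hi => by simp [hs'] at hi; exact hi.1)
    have hmeas : MeasurableSet (⋂ i ∈ s', dset i) :=
      Finset.measurableSet_biInter _ fun i _ => measurableSet_dset i
    have hper : ∀ x, x + 1 ∈ (⋂ i ∈ s', dset i) ↔ x ∈ ⋂ i ∈ s', dset i := by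
      intro x; simp only [Set.mem_iInter, dset_periodic]
    have hcard : (s'.map ⟨Nat.succ, Nat.succ_injective⟩).card = s'.card := Finset.card_map _
    by_cases h0 : 0 ∈ s
    · have e : s = insert 0 (s'.map ⟨Nat.succ, Nat.succ_injective⟩) := by
        ext i
        cases i <;> simp [h0, hmem]
      have e2 : (⋂ i ∈ s, dset i) = dset 0 ∩ (fun x : ℝ => 2 * x) ⁻¹' (⋂ i ∈ s', dset i) := by
        ext x
        conv_lhs => rw [e]
        simp [dset_succ]
      rw [e2, lam_half_top _ hmeas hper, ih', e, Finset.card_insert_of_notMem (by simp), hcard,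
        pow_succ, mul_comm]
    · have e : s = s'.map ⟨Nat.succ, Nat.succ_injective⟩ := by
        ext i
        cases i <;> simp [h0, hmem]
      have e2 : (⋂ i ∈ s, dset i) = (fun x : ℝ => 2 * x) ⁻¹' (⋂ i ∈ s', dset i) := by
        ext x
        conv_lhs => rw [e]
        simp [dset_succ]
      rw [e2, lam_half_all _ hmeas hper, ih', e, hcard]

lemma lam_dset (i : ℕ) : lam (dset i) = 2⁻¹ := by
  have := lam_inter (i + 1) {i} (by simp)
  simpa using this

lemma iIndepSet_dset : iIndepSet dset lam := by
  rw [iIndepSet_iff_meas_biInter measurableSet_dset]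
  intro s
  rw [lam_inter (s.sup id + 1) s (fun i hi => Nat.lt_succ_of_le (Finset.le_sup (f := id) hi))]
  simp only [lam_dset, Finset.prod_const]

lemma iIndepFun_digitR : iIndepFun (fun i x => digitR x i) lam := by
  have e : (fun i x => digitR x i) = fun i => (dset i).indicator (fun _ => (1 : ℝ)) :=
    funext digitR_eq
  rw [e]
  exact iIndepSet_dset.iIndepFun_indicator

lemma map_digitR (i : ℕ) : lam.map (fun x => digitR x i) = lam.map (fun x => digitR x 0) := by
  have hc : ∀ i, lam (dset i)ᶜ = 2⁻¹ := by
    intro i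
    rw [prob_compl_eq_one_sub (measurableSet_dset i), lam_dset, ENNReal.one_sub_inv_two]
  ext B hB
  rw [Measure.map_apply (measurable_digitR i) hB, Measure.map_apply (measurable_digitR 0) hB]
  rw [digitR_eq, digitR_eq]
  classical
  have key : ∀ i, lam ((dset i).indicator (fun _ => (1 : ℝ)) ⁻¹' B)
      = if (1 : ℝ) ∈ B then (if (0 : ℝ) ∈ B then 1 else 2⁻¹) else
        (if (0 : ℝ) ∈ B then 2⁻¹ else 0) := by
    intro i
    have h : (dset i).indicator (fun _ => (1 : ℝ)) ⁻¹' B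
      = if (1 : ℝ) ∈ B then (if (0 : ℝ) ∈ B then Set.univ else dset i) else
        (if (0 : ℝ) ∈ B then (dset i)ᶜ else ∅) := by
      ext x
      by_cases hx : x ∈ dset i <;> by_cases h1 : (1 : ℝ) ∈ B <;> by_cases h0 : (0 : ℝ) ∈ B <;>
        simp [hx, h1, h0]
    rw [h]
    split_ifs <;> simp only [measure_univ, lam_dset, hc, measure_empty]
  rw [key, key]

noncomputable def gsum (d : ℕ → ℝ) : ℝ := ∑' j : ℕ, d j / 2 ^ (j + 1)

lemma measurable_gsum : Measurable gsum := by
  unfold gsum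
  fun_prop

lemma unif_eq (m : ℕ) : (fun x => unif x m) = gsum ∘ (fun x j => digitR x (Nat.pair m j)) := rfl

lemma map_unif (m : ℕ) : lam.map (fun x => unif x m) = lam.map (fun x => unif x 0) := by
  have hm : ∀ m, Measurable (fun (x : ℝ) (j : ℕ) => digitR x (Nat.pair m j)) := fun m =>
    measurable_pi_lambda _ fun j => measurable_digitR _
  have key : ∀ m, lam.map (fun x => unif x m)
      = (Measure.infinitePi (fun _ : ℕ => lam.map (fun x => digitR x 0))).map gsum := by
    intro m
    rw [unif_eq, ← Measure.map_map measurable_gsum (hm m)]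
    have hi : iIndepFun (fun j x => digitR x (Nat.pair m j)) lam :=
      iIndepFun_digitR.precomp (g := fun j => Nat.pair m j)
        (fun a b h => (Nat.pair_eq_pair.1 h).2)
    rw [hi.map_fun_eq_infinitePi_map (fun j => measurable_digitR _)]
    simp only [map_digitR (Nat.pair m _)]
  rw [key, key]

noncomputable abbrev pastSig (S : Set ℕ) : MeasurableSpace ℝ :=
  ⨆ i ∈ S, MeasurableSpace.comap (fun x => digitR x i) inferInstance

lemma measurable_unif_past (S : Set ℕ) (m : ℕ) (h : ∀ j, Nat.pair m j ∈ S) :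
    Measurable[pastSig S] (fun x => unif x m) := by
  rw [unif_eq]
  refine measurable_gsum.comp (@measurable_pi_lambda _ _ _ (pastSig S) _ _ fun j => ?_)
  rw [measurable_iff_comap_le]
  exact le_iSup₂_of_le (Nat.pair m j) (h j) le_rfl

lemma measurable_unif (m : ℕ) : Measurable (fun x => unif x m) := by
  rw [unif_eq]
  exact measurable_gsum.comp (measurable_pi_lambda _ fun j => measurable_digitR _)

lemma indep_past (S T : Set ℕ) (h : Disjoint S T) : Indep (pastSig S) (pastSig T) lam :=
  indep_iSup_of_disjoint (fun i => (measurable_digitR i).comap_le) iIndepFun_digitR.iIndep h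

lemma pastSig_mono {S T : Set ℕ} (h : S ⊆ T) : pastSig S ≤ pastSig T :=
  biSup_mono h

lemma pastSig_le (S : Set ℕ) : pastSig S ≤ (inferInstance : MeasurableSpace ℝ) :=
  iSup₂_le fun i _ => (measurable_digitR i).comap_le

end Digits

lemma measurable_sampleFin {n : ℕ} (hn : 0 < n) (p : Fin n → ℝ) : Measurable (sampleFin hn p) := by
  classical
  let H : (Fin n → Prop) → Fin n := fun P =>
    let s : Finset (Fin n) := Finset.univ.filter P
    if hs : s.Nonempty then s.min' hs else ⟨0, hn⟩
  have e : sampleFin hn p = H ∘ (fun u y => u < ∑ z ∈ Finset.univ.filter fun z : Fin n => z ≤ y, p z) := by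
    funext u
    simp only [sampleFin, H, Function.comp]
  rw [e]
  refine (measurable_of_countable H).comp (measurable_pi_lambda _ fun y => ?_)
  exact measurableSet_setOfPred.1 measurableSet_Iio

lemma measurable_sampleOn {β : Type*} [Fintype β] [Nonempty β] [MeasurableSpace β]
    (p : β → ℝ) : Measurable (sampleOn p) :=
  (measurable_of_countable _).comp (measurable_sampleFin _ _)

namespace POMDP

variable (Γ : POMDP)

/-- one-step map -/
noncomputable def stepF (a : Γ.A) (z : Γ.K × ℝ) : Γ.K := (sampleOn (Γ.q z.1 a) z.2).1

lemma measurable_stepF (a : Γ.A) : Measurable (Γ.stepF a) :=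
  measurable_from_prod_countable_right fun k =>
    measurable_fst.comp (measurable_sampleOn (Γ.q k a))

lemma hist_length (b : ℕ → Γ.A) (ω : Γ.Env) (m : ℕ) :
    (Γ.traj (Γ.blindStrat b) ω m).2.length = m := by
  induction m with
  | zero => rfl
  | succ m ih => simp [traj, ih]

lemma act_blind (b : ℕ → Γ.A) (ω : Γ.Env) (m : ℕ) : Γ.act (Γ.blindStrat b) ω m = b m := by
  simp [act, hist, blindStrat, hist_length]

lemma state_succ (b : ℕ → Γ.A) (ω : Γ.Env) (m : ℕ) :
    Γ.state (Γ.blindStrat b) ω (m + 1)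
      = Γ.stepF (b m) (Γ.state (Γ.blindStrat b) ω m, unif ω.2 m) := by
  have h : Γ.blindStrat b (Γ.traj (Γ.blindStrat b) ω m).2 = b m := Γ.act_blind b ω m
  simp only [state, traj, stepF, h]

lemma measurable_state_past (b : ℕ → Γ.A) (k : Γ.K) (m : ℕ) :
    Measurable[pastSig {i | (Nat.unpair i).1 < m}]
      (fun x => Γ.state (Γ.blindStrat b) (k, x) m) := by
  induction m with
  | zero => exact measurable_const
  | succ m ih =>
    have h1 := ih.mono (pastSig_mono (T := {i | (Nat.unpair i).1 < m + 1})
      (fun i hi => Nat.lt_succ_of_lt hi)) le_rfl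
    have h2 := measurable_unif_past {i | (Nat.unpair i).1 < m + 1} m (fun j => by simp)
    simp only [state_succ]
    exact (Γ.measurable_stepF (b m)).comp (h1.prodMk h2)

lemma measurable_state (b : ℕ → Γ.A) (k : Γ.K) (m : ℕ) :
    Measurable (fun x => Γ.state (Γ.blindStrat b) (k, x) m) :=
  (Γ.measurable_state_past b k m).mono (pastSig_le _) le_rfl

noncomputable def stp (b : ℕ → Γ.A) (k : Γ.K) (m : ℕ) (k' : Γ.K) : ℝ :=
  lam.real {x | Γ.state (Γ.blindStrat b) (k, x) m = k'}

noncomputable def ker (a : Γ.A) (j k' : Γ.K) : ℝ :=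
  lam.real {x | Γ.stepF a (j, unif x 0) = k'}

lemma stp_nonneg (b : ℕ → Γ.A) (k : Γ.K) (m : ℕ) (k' : Γ.K) : 0 ≤ Γ.stp b k m k' :=
  measureReal_nonneg

lemma stp_zero (b : ℕ → Γ.A) (k k' : Γ.K) : Γ.stp b k 0 k' = if k = k' then 1 else 0 := by
  by_cases h : k = k' <;> simp [stp, state, traj, h, measureReal_def]

lemma stp_succ (b : ℕ → Γ.A) (k : Γ.K) (m : ℕ) (k' : Γ.K) :
    Γ.stp b k (m + 1) k' = ∑ j, Γ.stp b k m j * Γ.ker (b m) j k' := by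
  have hmB : ∀ j, MeasurableSet {u : ℝ | Γ.stepF (b m) (j, u) = k'} := fun j =>
    ((Γ.measurable_stepF (b m)).comp measurable_prodMk_left) (measurableSet_singleton k')
  have hX : ∀ j, MeasurableSet {x | Γ.state (Γ.blindStrat b) (k, x) m = j} := fun j =>
    Γ.measurable_state b k m (measurableSet_singleton j)
  have hU : ∀ j, MeasurableSet {x | Γ.stepF (b m) (j, unif x m) = k'} := fun j =>
    measurable_unif m (hmB j)
  have e : {x | Γ.state (Γ.blindStrat b) (k, x) (m + 1) = k'}
      = ⋃ j ∈ (Finset.univ : Finset Γ.K), ({x | Γ.state (Γ.blindStrat b) (k, x) m = j} ∩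
          {x | Γ.stepF (b m) (j, unif x m) = k'}) := by
    ext x
    simp [state_succ]
  unfold stp
  rw [e, measureReal_biUnion_finset]
  · refine Finset.sum_congr rfl fun j _ => ?_
    have hind : ProbabilityTheory.Indep (pastSig {i | (Nat.unpair i).1 < m})
        (pastSig {i | (Nat.unpair i).1 = m}) lam := by
      apply indep_past
      rw [Set.disjoint_left]
      intro i hi hi'
      simp only [Set.mem_ofPred_eq] at hi hi'
      omega
    have := (ProbabilityTheory.Indep_iff _ _ _).1 hind
      {x | Γ.state (Γ.blindStrat b) (k, x) m = j} {x | Γ.stepF (b m) (j, unif x m) = k'}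
      (Γ.measurable_state_past b k m (measurableSet_singleton j))
      (measurable_unif_past _ m (fun j => by simp) (hmB j))
    rw [measureReal_def, this, ENNReal.toReal_mul]
    congr 1
    unfold ker
    rw [measureReal_def]
    congr 1
    have h0 := Measure.map_apply (μ := lam) (measurable_unif 0) (hmB j)
    have h1 := Measure.map_apply (μ := lam) (measurable_unif m) (hmB j)
    rw [map_unif m, h0] at h1
    exact h1.symm
  · intro i _ j _ hij
    rw [Function.onFun, Set.disjoint_left]
    rintro x ⟨h1, _⟩ ⟨h2, _⟩
    exact hij (h1.symm.trans h2)
  · exact fun j _ => (hX j).inter (hU j)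

lemma stp_integral (b : ℕ → Γ.A) (k : Γ.K) (m : ℕ) (f : Γ.K → ℝ) :
    ∫ x, f (Γ.state (Γ.blindStrat b) (k, x) m) ∂lam = ∑ k', Γ.stp b k m k' * f k' := by
  have hp : IsProbabilityMeasure (lam.map (fun x => Γ.state (Γ.blindStrat b) (k, x) m)) :=
    Measure.isProbabilityMeasure_map (Γ.measurable_state b k m).aemeasurable
  rw [← integral_map (f := f) (Γ.measurable_state b k m).aemeasurable
    (measurable_of_countable f).aestronglyMeasurable, integral_fintype (Integrable.of_finite)]
  refine Finset.sum_congr rfl fun k' _ => ?_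
  rw [map_measureReal_apply (Γ.measurable_state b k m) (measurableSet_singleton k')]
  rfl

lemma stp_sum (b : ℕ → Γ.A) (k : Γ.K) (m : ℕ) : ∑ k', Γ.stp b k m k' = 1 := by
  have := Γ.stp_integral b k m (fun _ => 1)
  simpa using this.symm

lemma stp_congr (b b' : ℕ → Γ.A) (k : Γ.K) (m : ℕ) (h : ∀ t < m, b t = b' t) :
    Γ.stp b k m = Γ.stp b' k m := by
  induction m with
  | zero => funext k'; simp [stp_zero]
  | succ m ih =>
    funext k'
    rw [stp_succ, stp_succ, ih (fun t ht => h t (by omega)), h m (by omega)]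

lemma stp_add (b : ℕ → Γ.A) (k : Γ.K) (m n : ℕ) (k' : Γ.K) :
    Γ.stp b k (m + n) k' = ∑ j, Γ.stp b k m j * Γ.stp (shiftSeq b m) j n k' := by
  induction n generalizing k' with
  | zero => simp [stp_zero]
  | succ n ih =>
    rw [← add_assoc, stp_succ]
    simp only [ih, stp_succ, Finset.sum_mul, Finset.mul_sum]
    rw [Finset.sum_comm]
    refine Finset.sum_congr rfl fun j _ => Finset.sum_congr rfl fun i _ => ?_
    simp only [shiftSeq]
    ring

lemma env_integral (p : Γ.K → ℝ) (hp : ∀ k, 0 ≤ p k) (F : Γ.Env → ℝ)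
    (hF : ∀ k, Integrable (fun x => F (k, x)) lam) :
    ∫ ω, F ω ∂(Γ.envMeasure p) = ∑ k, p k * ∫ x, F (k, x) ∂lam := by
  have e : Γ.envMeasure p
      = ∑ k, ENNReal.ofReal (p k) • (lam.map (Prod.mk k)) := by
    have h1 : ∀ k : Γ.K, lam.map (Prod.mk k) = (Measure.dirac k).prod lam :=
      fun k => (Measure.dirac_prod k).symm
    ext s hs
    simp only [envMeasure, vecMeasure, h1]
    rw [Measure.prod_apply hs]
    rw [lintegral_finset_sum_measure, Measure.finset_sum_apply]
    refine Finset.sum_congr rfl fun k _ => ?_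
    rw [lintegral_smul_measure, Measure.smul_apply, Measure.prod_apply hs]
  have hemb : ∀ k : Γ.K, MeasurableEmbedding (Prod.mk k : ℝ → Γ.K × ℝ) :=
    fun k => MeasurableEmbedding.prodMk_left k MeasurableEmbedding.id
  have hint : ∀ k : Γ.K, Integrable F (lam.map (Prod.mk k)) := fun k =>
    (hemb k).integrable_map_iff.2 (hF k)
  rw [e, integral_finset_sum_measure]
  · refine Finset.sum_congr rfl fun k _ => ?_
    rw [integral_smul_measure, (hemb k).integral_map, ENNReal.toReal_ofReal (hp k), smul_eq_mul]
  · exact fun k _ => (hint k).smul_measure ENNReal.ofReal_ne_top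

lemma diracBelief_nonneg (k k' : Γ.K) : 0 ≤ diracBelief k k' := by
  unfold diracBelief; split_ifs <;> norm_num

lemma env_integral_dirac (k : Γ.K) (F : Γ.Env → ℝ)
    (hF : ∀ k, Integrable (fun x => F (k, x)) lam) :
    ∫ ω, F ω ∂(Γ.envMeasure (diracBelief k)) = ∫ x, F (k, x) ∂lam := by
  rw [env_integral _ _ (Γ.diracBelief_nonneg k) _ hF]
  simp [diracBelief]

lemma rew_eq (b : ℕ → Γ.A) (ω : Γ.Env) (m : ℕ) :
    Γ.rew (Γ.blindStrat b) ω m = Γ.g (Γ.state (Γ.blindStrat b) ω m) (b m) := by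
  rw [rew, act_blind]

lemma measurable_rew (b : ℕ → Γ.A) (k : Γ.K) (m : ℕ) :
    Measurable (fun x => Γ.rew (Γ.blindStrat b) (k, x) m) := by
  simp only [rew_eq]
  exact (measurable_of_countable (fun j => Γ.g j (b m))).comp (Γ.measurable_state b k m)

lemma measurable_avg (b : ℕ → Γ.A) (k : Γ.K) (n : ℕ) :
    Measurable (fun x => Γ.avg (Γ.blindStrat b) (k, x) n) := by
  unfold avg
  exact (Finset.measurable_sum _ fun m _ => Γ.measurable_rew b k m).const_mul _

lemma rew_mem (σ : Γ.Strategy) (ω : Γ.Env) (m : ℕ) : Γ.rew σ ω m ∈ Set.Icc (0 : ℝ) 1 :=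
  ⟨Γ.g_nonneg _ _, Γ.g_le_one _ _⟩

lemma avg_mem (σ : Γ.Strategy) (ω : Γ.Env) (n : ℕ) : Γ.avg σ ω n ∈ Set.Icc (0 : ℝ) 1 := by
  unfold avg
  have h0 : 0 ≤ ∑ m ∈ Finset.range n, Γ.rew σ ω m :=
    Finset.sum_nonneg fun m _ => (Γ.rew_mem σ ω m).1
  have h1 : ∑ m ∈ Finset.range n, Γ.rew σ ω m ≤ n := by
    have := Finset.sum_le_sum (s := Finset.range n) fun m _ => (Γ.rew_mem σ ω m).2
    simpa using this
  constructor
  · positivity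
  · rw [one_div, inv_mul_eq_div]
    exact div_le_one_of_le₀ h1 (Nat.cast_nonneg n)

lemma integrable_rew (b : ℕ → Γ.A) (k : Γ.K) (m : ℕ) :
    Integrable (fun x => Γ.rew (Γ.blindStrat b) (k, x) m) lam :=
  Integrable.of_mem_Icc 0 1 (Γ.measurable_rew b k m).aemeasurable
    (Eventually.of_forall fun x => Γ.rew_mem _ _ _)

lemma integrable_avg (b : ℕ → Γ.A) (k : Γ.K) (n : ℕ) :
    Integrable (fun x => Γ.avg (Γ.blindStrat b) (k, x) n) lam :=
  Integrable.of_mem_Icc 0 1 (Γ.measurable_avg b k n).aemeasurable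
    (Eventually.of_forall fun x => Γ.avg_mem _ _ _)

lemma integrable_liminf (b : ℕ → Γ.A) (k : Γ.K) :
    Integrable (fun x => atTop.liminf (Γ.avg (Γ.blindStrat b) (k, x))) lam := by
  refine Integrable.of_mem_Icc 0 1
    (Measurable.liminf (fun n => Γ.measurable_avg b k n)).aemeasurable
    (Eventually.of_forall fun x => ?_)
  have hb : atTop.IsBoundedUnder (· ≤ ·) (Γ.avg (Γ.blindStrat b) (k, x)) :=
    isBoundedUnder_of ⟨1, fun n => (Γ.avg_mem _ _ n).2⟩
  have hb' : atTop.IsBoundedUnder (· ≥ ·) (Γ.avg (Γ.blindStrat b) (k, x)) :=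
    isBoundedUnder_of ⟨0, fun n => (Γ.avg_mem _ _ n).1⟩
  constructor
  · exact le_liminf_of_le hb.isCoboundedUnder_ge
      (Eventually.of_forall fun n => (Γ.avg_mem _ _ n).1)
  · exact liminf_le_of_le hb' (fun c hc => by
      obtain ⟨n, hn⟩ := hc.exists
      exact hn.trans (Γ.avg_mem _ _ n).2)

lemma pay_eq (p : Γ.K → ℝ) (hp : ∀ k, 0 ≤ p k) (b : ℕ → Γ.A) :
    Γ.pay p (Γ.blindStrat b) = ∑ k, p k * Γ.payK k (Γ.blindStrat b) := by
  unfold payK pay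
  rw [Γ.env_integral p hp _ (fun k => Γ.integrable_liminf b k)]
  refine Finset.sum_congr rfl fun k _ => ?_
  rw [Γ.env_integral_dirac k _ (fun k => Γ.integrable_liminf b k)]

lemma stateProb_eq (b : ℕ → Γ.A) (k : Γ.K) (m : ℕ) (k' : Γ.K) :
    Γ.stateProb k (Γ.blindStrat b) m k' = Γ.stp b k m k' := by
  have hms : MeasurableSet {ω : Γ.Env | Γ.state (Γ.blindStrat b) ω m = k'} := by
    have : Measurable (fun ω : Γ.Env => Γ.state (Γ.blindStrat b) ω m) :=
      measurable_from_prod_countable_right fun k => Γ.measurable_state b k m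
    exact this (measurableSet_singleton k')
  have hms' : MeasurableSet {x | Γ.state (Γ.blindStrat b) (k, x) m = k'} :=
    Γ.measurable_state b k m (measurableSet_singleton k')
  unfold stateProb prob stp
  rw [← measureReal_def, ← integral_indicator_one hms, ← integral_indicator_one hms',
    env_integral_dirac]
  · rfl
  · intro j
    exact (integrable_const (1 : ℝ)).indicator
      (Γ.measurable_state b j m (measurableSet_singleton k'))

/-- Expected total reward over `n` stages. -/
noncomputable def tot (b : ℕ → Γ.A) (k : Γ.K) (n : ℕ) : ℝ :=
  ∑ m ∈ Finset.range n, ∑ k', Γ.stp b k m k' * Γ.g k' (b m)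

lemma integral_avg (b : ℕ → Γ.A) (k : Γ.K) (n : ℕ) :
    ∫ x, Γ.avg (Γ.blindStrat b) (k, x) n ∂lam = (1 / n : ℝ) * Γ.tot b k n := by
  unfold avg tot
  rw [integral_const_mul, integral_finset_sum _ (fun m _ => Γ.integrable_rew b k m)]
  simp only [rew_eq]
  simp only [fun m => Γ.stp_integral b k m (fun j => Γ.g j (b m))]

lemma tot_congr (b b' : ℕ → Γ.A) (k : Γ.K) (n : ℕ) (h : ∀ t < n, b t = b' t) :
    Γ.tot b k n = Γ.tot b' k n := by
  unfold tot
  refine Finset.sum_congr rfl fun m hm => ?_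
  rw [Finset.mem_range] at hm
  rw [Γ.stp_congr b b' k m (fun t ht => h t (by omega)), h m hm]

lemma tot_add (b : ℕ → Γ.A) (k : Γ.K) (m n : ℕ) :
    Γ.tot b k (m + n) = Γ.tot b k m + ∑ j, Γ.stp b k m j * Γ.tot (shiftSeq b m) j n := by
  unfold tot
  rw [Finset.sum_range_add]
  congr 1
  simp only [stp_add, Finset.sum_mul, Finset.mul_sum]
  rw [Finset.sum_comm (s := Finset.univ) (t := Finset.range n)]
  refine Finset.sum_congr rfl fun x _ => ?_
  rw [Finset.sum_comm]
  refine Finset.sum_congr rfl fun j _ => Finset.sum_congr rfl fun i _ => ?_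
  simp only [shiftSeq]
  ring

end POMDP

/-- **Lemma 5.** If `n0` is such that on every block the expected average reward from any
`k ∈ B^i_{j_s}` under the shifted strategy is at least `γ^i_∞ - ε`, and
`γ^{p*}_∞(σ) = v_∞(p₁)`, then for every `S ≥ 1` the expected average reward of `σ'` over
the first `S·n0` stages, starting from `p*`, is at least `v_∞(p₁) - ε`. -/
theorem blind_block_payoff (Γ : POMDP) (hΓ : Γ.Blind)
    (pstar : Γ.K → ℝ) (hps : IsBelief pstar) (as : ℕ → Γ.A)
    (herg : ∀ k, 0 < pstar k →
      ∀ᵐ ω ∂(Γ.envMeasure (diracBelief k)),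
        Tendsto (Γ.avg (Γ.blindStrat as) ω) atTop (nhds (Γ.payK k (Γ.blindStrat as))))
    (r : ℕ) (Kc : Fin r → Finset Γ.K) (γv : Fin r → ℝ)
    (hKc : ∀ k, 0 < pstar k ↔ ∃ i, k ∈ Kc i)
    (hcl : ∀ i, ∀ k ∈ Kc i, Γ.payK k (Γ.blindStrat as) = γv i)
    (hdist : ∀ i j, i ≠ j → γv i ≠ γv j)
    (hne : ∀ i, (Kc i).Nonempty)
    (ε : ℝ) (hε : 0 < ε) (n0 : ℕ) (hn0 : 1 ≤ n0)
    (hblock : ∀ s : ℕ, ∀ i : Fin r,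
      ∀ k' ∈ Γ.superSupp as Kc (repStage Γ as Kc n0 s) i,
        γv i - ε ≤ ∫ ω, Γ.avg (Γ.blindStrat (shiftSeq as (repStage Γ as Kc n0 s))) ω n0
            ∂(Γ.envMeasure (diracBelief k')))
    (p1 : Γ.K → ℝ) (hp1 : IsBelief p1)
    (hval : Γ.pay pstar (Γ.blindStrat as) = Γ.val p1) :
    ∀ S : ℕ, 1 ≤ S →
      Γ.val p1 - ε ≤
        ∫ ω, Γ.avg (Γ.blindStrat (blindSigma' Γ as Kc n0)) ω (S * n0)
          ∂(Γ.envMeasure pstar) := by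
  classical
  set b := blindSigma' Γ as Kc n0 with hb
  have hshift : ∀ s, ∀ t < n0,
      shiftSeq b (s * n0) t = shiftSeq as (repStage Γ as Kc n0 s) t := by
    intro s t ht
    simp only [shiftSeq, hb, blindSigma']
    have h1 : (s * n0 + t) / n0 = s := by
      rw [mul_comm, Nat.mul_add_div (by omega), Nat.div_eq_of_lt ht, add_zero]
    have h2 : (s * n0 + t) % n0 = t := by
      rw [mul_comm, Nat.mul_add_mod, Nat.mod_eq_of_lt ht]
    rw [h1, h2]
  have hrep : ∀ s, Γ.superSupp as Kc (repStage Γ as Kc n0 (s + 1))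
      = Γ.superSupp as Kc (repStage Γ as Kc n0 s + n0) := by
    intro s
    rw [repStage]
    exact Nat.find_spec (p := fun m => Γ.superSupp as Kc m
        = Γ.superSupp as Kc (repStage Γ as Kc n0 s + n0)) _
  have hmem : ∀ m i k', k' ∈ Γ.superSupp as Kc m i ↔ ∃ k ∈ Kc i, 0 < Γ.stp as k m k' := by
    intro m i k'
    simp only [POMDP.superSupp, Set.mem_ofPred_eq, POMDP.stateProb_eq]
  have hsupp : ∀ s i, ∀ k ∈ Kc i, ∀ k', 0 < Γ.stp b k (s * n0) k' →
      k' ∈ Γ.superSupp as Kc (repStage Γ as Kc n0 s) i := by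
    intro s i k hk
    induction s with
    | zero =>
      intro k' h
      rw [hmem]
      refine ⟨k, hk, ?_⟩
      rw [zero_mul, POMDP.stp_zero] at h
      rw [repStage, POMDP.stp_zero]
      exact h
    | succ s ih =>
      intro k'' h
      rw [Nat.succ_mul, POMDP.stp_add] at h
      obtain ⟨j, -, hj⟩ := Finset.exists_lt_of_sum_lt (s := Finset.univ)
        (f := fun _ : Γ.K => (0 : ℝ)) (by simpa using h)
      have hj1 : 0 < Γ.stp b k (s * n0) j := by
        rcases (Γ.stp_nonneg b k (s * n0) j).eq_or_lt with h0 | h0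
        · rw [← h0, zero_mul] at hj; exact absurd hj (lt_irrefl _)
        · exact h0
      have hj2 := pos_of_mul_pos_right hj hj1.le
      rw [Γ.stp_congr _ _ j n0 (hshift s)] at hj2
      obtain ⟨k0, hk0, h0⟩ := (hmem _ _ _).1 (ih j hj1)
      rw [hrep, hmem]
      refine ⟨k0, hk0, ?_⟩
      rw [POMDP.stp_add]
      exact Finset.sum_pos' (fun i _ => mul_nonneg (Γ.stp_nonneg _ _ _ _) (Γ.stp_nonneg _ _ _ _))
        ⟨j, Finset.mem_univ _, mul_pos h0 hj2⟩
  have hn0' : (0 : ℝ) < n0 := by exact_mod_cast hn0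
  have htot : ∀ i, ∀ k ∈ Kc i, ∀ s : ℕ, (s * n0 : ℝ) * (γv i - ε) ≤ Γ.tot b k (s * n0) := by
    intro i k hk s
    induction s with
    | zero => simp [POMDP.tot]
    | succ s ih =>
      rw [Nat.succ_mul, POMDP.tot_add]
      have h1 : n0 * (γv i - ε) ≤
          ∑ j, Γ.stp b k (s * n0) j * Γ.tot (shiftSeq b (s * n0)) j n0 := by
        rw [← one_mul (n0 * (γv i - ε)), ← Γ.stp_sum b k (s * n0), Finset.sum_mul]
        refine Finset.sum_le_sum fun j _ => ?_
        rcases (Γ.stp_nonneg b k (s * n0) j).eq_or_lt with h0 | h0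
        · simp [← h0]
        · refine mul_le_mul_of_nonneg_left ?_ h0.le
          have := hblock s i j (hsupp s i k hk j h0)
          rw [Γ.env_integral_dirac j (fun ω => Γ.avg _ ω n0) (fun k => Γ.integrable_avg _ k n0),
            POMDP.integral_avg, ← Γ.tot_congr _ _ j n0 (hshift s), one_div, inv_mul_eq_div,
            le_div_iff₀ hn0'] at this
          linarith
      push_cast
      linarith
  intro S hS
  have hSn : (0 : ℝ) < ((S * n0 : ℕ) : ℝ) := by
    have : 0 < S * n0 := Nat.mul_pos hS hn0
    exact_mod_cast this
  rw [← hval, Γ.pay_eq _ hps.1, Γ.env_integral pstar hps.1 (fun ω => Γ.avg _ ω (S * n0))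
    (fun k => Γ.integrable_avg _ k _)]
  have : ∑ k, pstar k * Γ.payK k (Γ.blindStrat as) - ε
      = ∑ k, pstar k * (Γ.payK k (Γ.blindStrat as) - ε) := by
    simp only [mul_sub, Finset.sum_sub_distrib, ← Finset.sum_mul, hps.2, one_mul]
  rw [this]
  refine Finset.sum_le_sum fun k _ => ?_
  rcases (hps.1 k).eq_or_lt with h0 | h0
  · simp [← h0]
  · refine mul_le_mul_of_nonneg_left ?_ h0.le
    obtain ⟨i, hi⟩ := (hKc k).1 h0
    rw [hcl i k hi, POMDP.integral_avg, one_div, inv_mul_eq_div, le_div_iff₀ hSn]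
    have := htot i k hi S
    push_cast
    linarith

end PomdpPaper
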